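/- There exists a constant d₀ such that the following holds. Let d ≥ d₀ be an integer and B ≥ 4. Let f: ℝ^d → {0,1} be measurable, and define h(s) = ∫_{S^{d−1}} f(√s·ω) dμ(ω) for s > 0, where μ is the uniform probability measure on the unit sphere S^{d−1} ⊆ ℝ^d. Assume (i) ∫_{Bd/2}^{2Bd} (1−h(s)) ds ≤ 1/(Bd) and (ii) ∫_0^{2d} h(s) ds ≤ 1/d. Then there exist τ ∈ [d, Bd] and a unit vector u ∈ ℝ^d such that, writing g ∼ N(0, τ/d)^d, one has E[⟨u,g⟩²·f(g)] ≥ (τ/d + 1/(4Bd))·P(f(g)=1) and P(f(g)=1) ≥ 1/(40B²d). -/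

import Mathlib

open MeasureTheory ProbabilityTheory Real
open scoped RealInnerProductSpace

/-- The law `N(0,σ²)^n` of a random vector of `ℝⁿ` with `n` independent centered Gaussian
coordinates of variance `σ²`. -/
noncomputable def gaussianE (n : ℕ) (σ2 : ℝ) : Measure (EuclideanSpace ℝ (Fin n)) :=
  Measure.map (⇑(EuclideanSpace.equiv (Fin n) ℝ).symm)
    (Measure.pi fun _ : Fin n => gaussianReal 0 (Real.toNNReal σ2))

/-- The uniform probability measure on the unit sphere of `ℝ^d`. -/
noncomputable def sphereUniform (d : ℕ) :
    Measure (Metric.sphere (0 : EuclideanSpace ℝ (Fin d)) 1) :=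
  ((volume : Measure (EuclideanSpace ℝ (Fin d))).toSphere Set.univ)⁻¹ •
    (volume : Measure (EuclideanSpace ℝ (Fin d))).toSphere

/-- The average of `f` over the sphere of radius `√s` centered at the origin. -/
noncomputable def sphAvg (d : ℕ) (f : EuclideanSpace ℝ (Fin d) → ℝ) (s : ℝ) : ℝ :=
  ∫ ω, f (Real.sqrt s • (ω : EuclideanSpace ℝ (Fin d))) ∂(sphereUniform d)

theorem pi_gaussianReal_eq_withDensity (n : ℕ) {v : NNReal} (hv : v ≠ 0) :
    (Measure.pi fun _ : Fin n => gaussianReal 0 v) =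
      (volume : Measure (Fin n → ℝ)).withDensity
        (fun x => ENNReal.ofReal (∏ i, gaussianPDFReal 0 v (x i))) := by
  refine Measure.pi_eq fun s hs => ?_
  rw [withDensity_apply _ (MeasurableSet.univ_pi hs), volume_pi, Measure.restrict_pi_pi,
    ← ofReal_integral_eq_lintegral_ofReal
      (Integrable.fintype_prod fun i => (integrable_gaussianPDFReal 0 v).restrict)
      (ae_of_all _ fun x => Finset.prod_nonneg fun i _ => gaussianPDFReal_nonneg _ _ _),
    integral_fintype_prod_eq_prod (fun _ => gaussianPDFReal 0 v),
    ENNReal.ofReal_prod_of_nonneg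
      fun i _ => integral_nonneg fun x => gaussianPDFReal_nonneg _ _ _]
  refine Finset.prod_congr rfl fun i _ => ?_
  rw [gaussianReal_apply_eq_integral _ hv]

theorem prod_gaussianPDFReal (n : ℕ) {l : ℝ} (hl : 0 < l) (x : EuclideanSpace ℝ (Fin n)) :
    ∏ i, gaussianPDFReal 0 (Real.toNNReal (1 / (2 * l))) (x i) =
      (l / π) ^ ((n : ℝ) / 2) * exp (-l * ‖x‖ ^ 2) := by
  simp only [gaussianPDFReal, Finset.prod_mul_distrib, ← Real.exp_sum]
  rw [Real.coe_toNNReal _ (by positivity), EuclideanSpace.real_norm_sq_eq, Finset.mul_sum]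
  congr 1
  · rw [Finset.prod_const, Finset.card_univ, Fintype.card_fin, ← Real.sqrt_inv,
      Real.sqrt_eq_rpow, ← Real.rpow_natCast, ← Real.rpow_mul (by positivity)]
    congr 1
    · field_simp
    · ring
  · congr 1
    refine Finset.sum_congr rfl fun i _ => ?_
    field_simp
    ring

theorem gaussianE_eq_withDensity (n : ℕ) {l : ℝ} (hl : 0 < l) :
    gaussianE n (1 / (2 * l)) = (volume : Measure (EuclideanSpace ℝ (Fin n))).withDensity
      (fun x => ENNReal.ofReal ((l / π) ^ ((n : ℝ) / 2) * exp (-l * ‖x‖ ^ 2))) := by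
  have hv : Real.toNNReal (1 / (2 * l)) ≠ 0 := by
    simpa using hl
  ext s hs
  have hm : Measurable (⇑(EuclideanSpace.equiv (Fin n) ℝ).symm) :=
    (EuclideanSpace.equiv (Fin n) ℝ).symm.continuous.measurable
  rw [gaussianE, Measure.map_apply hm hs, pi_gaussianReal_eq_withDensity n hv,
    withDensity_apply _ (hm hs), withDensity_apply _ hs,
    ← (PiLp.volume_preserving_toLp (Fin n)).setLIntegral_comp_preimage hs (by fun_prop)]
  refine lintegral_congr fun x => ?_
  rw [← prod_gaussianPDFReal n hl]

theorem integral_gaussianE (n : ℕ) {l : ℝ} (hl : 0 < l) (φ : EuclideanSpace ℝ (Fin n) → ℝ) :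
    ∫ x, φ x ∂(gaussianE n (1 / (2 * l))) =
      (l / π) ^ ((n : ℝ) / 2) * ∫ x, φ x * exp (-l * ‖x‖ ^ 2) := by
  rw [gaussianE_eq_withDensity n hl, integral_withDensity_eq_integral_toReal_smul (by fun_prop)
    (ae_of_all _ fun x => ENNReal.ofReal_lt_top), ← integral_const_mul]
  refine integral_congr_ae (ae_of_all _ fun x => ?_)
  simp only [smul_eq_mul]
  rw [ENNReal.toReal_ofReal (by positivity)]
  ring

section

variable {V : Type*} [NormedAddCommGroup V] [InnerProductSpace ℝ V] [FiniteDimensional ℝ V]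
  [MeasurableSpace V] [BorelSpace V]

theorem integrable_exp_neg_mul_sq_norm {l : ℝ} (hl : 0 < l) :
    Integrable (fun x : V => exp (-l * ‖x‖ ^ 2)) := by
  refine Integrable.of_integral_ne_zero ?_
  rw [GaussianFourier.integral_rexp_neg_mul_sq_norm hl]
  positivity

theorem sq_mul_exp_neg_le {l r : ℝ} (hl : 0 < l) :
    r ^ 2 * exp (-l * r ^ 2) ≤ 2 / l * exp (-(l / 2) * r ^ 2) := by
  have h := Real.add_one_le_exp (l / 2 * r ^ 2)
  have h2 : exp (-(l / 2) * r ^ 2) = exp (l / 2 * r ^ 2) * exp (-l * r ^ 2) := by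
    rw [← Real.exp_add]
    ring_nf
  rw [h2, ← mul_assoc]
  refine mul_le_mul_of_nonneg_right ?_ (Real.exp_pos _).le
  rw [div_mul_eq_mul_div, le_div_iff₀ hl]
  linarith

theorem integrable_sq_norm_mul_exp {l : ℝ} (hl : 0 < l) :
    Integrable (fun x : V => ‖x‖ ^ 2 * exp (-l * ‖x‖ ^ 2)) := by
  refine ((integrable_exp_neg_mul_sq_norm (V := V) (half_pos hl)).const_mul (2 / l)).mono'
    (by fun_prop) (ae_of_all _ fun x => ?_)
  rw [Real.norm_of_nonneg (by positivity)]
  exact sq_mul_exp_neg_le hl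

theorem hasDerivAt_integral_mul_exp {f : V → ℝ} (hf : Measurable f) (hf1 : ∀ x, |f x| ≤ 1)
    {l : ℝ} (hl : 0 < l) :
    HasDerivAt (fun t => ∫ x, f x * exp (-t * ‖x‖ ^ 2))
      (-∫ x, f x * (‖x‖ ^ 2 * exp (-l * ‖x‖ ^ 2))) l := by
  have key := hasDerivAt_integral_of_dominated_loc_of_deriv_le (μ := (volume : Measure V))
    (F := fun t x => f x * exp (-t * ‖x‖ ^ 2))
    (F' := fun t x => -(f x * (‖x‖ ^ 2 * exp (-t * ‖x‖ ^ 2))))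
    (x₀ := l) (s := Set.Ioi (l / 2))
    (bound := fun x => ‖x‖ ^ 2 * exp (-(l / 2) * ‖x‖ ^ 2))
    (Ioi_mem_nhds (by linarith)) (Filter.Eventually.of_forall fun t => by fun_prop)
    ((integrable_exp_neg_mul_sq_norm hl).bdd_mul hf.aestronglyMeasurable
      (ae_of_all _ hf1)) (by fun_prop)
    (ae_of_all _ fun x t ht => ?_) (integrable_sq_norm_mul_exp (half_pos hl))
    (ae_of_all _ fun x t ht => ?_)
  · rw [← integral_neg]
    exact key.2
  · rw [norm_neg, norm_mul, Real.norm_of_nonneg (by positivity : 0 ≤ ‖x‖ ^ 2 * exp (-t * ‖x‖ ^ 2))]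
    refine (mul_le_of_le_one_left (by positivity) (hf1 x)).trans ?_
    have : l / 2 < t := ht
    gcongr
  · have h := (((hasDerivAt_id t).neg.mul_const (‖x‖ ^ 2)).exp).const_mul (f x)
    refine h.congr_deriv ?_
    simp only [id, Pi.neg_apply]
    ring

end

theorem integrableOn_rpow_mul_exp_neg_mul {a l : ℝ} (ha : 0 < a) (hl : 0 < l) :
    IntegrableOn (fun s : ℝ => s ^ (a - 1) * exp (-(l * s))) (Set.Ioi 0) := by
  refine Integrable.of_integral_ne_zero ?_
  rw [Real.integral_rpow_mul_exp_neg_mul_Ioi ha hl]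
  have := Real.Gamma_pos_of_pos ha
  positivity

theorem rpow_mul_exp_neg_mul_le {a l t : ℝ} (ha : 1 ≤ a) (hl : 0 < l) (ht : 0 < t) :
    t ^ (a - 1) * exp (-(l * t)) ≤ l * ((1 / l) ^ a * Real.Gamma a) := by
  have hint := integrableOn_rpow_mul_exp_neg_mul (by linarith : 0 < a) hl
  have hsub : Set.Ioi t ⊆ Set.Ioi 0 := Set.Ioi_subset_Ioi ht.le
  have h1 : ∫ s in Set.Ioi t, t ^ (a - 1) * exp (-l * s) ≤
      ∫ s in Set.Ioi t, s ^ (a - 1) * exp (-(l * s)) := by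
    refine setIntegral_mono_on ((integrableOn_exp_mul_Ioi (neg_lt_zero.2 hl) t).const_mul _)
      (hint.mono_set hsub) measurableSet_Ioi fun s hs => ?_
    have hs' : t < s := hs
    rw [neg_mul]
    have := Real.rpow_le_rpow ht.le hs'.le (by linarith : 0 ≤ a - 1)
    gcongr
  have h2 : ∫ s in Set.Ioi t, s ^ (a - 1) * exp (-(l * s)) ≤
      ∫ s in Set.Ioi 0, s ^ (a - 1) * exp (-(l * s)) := by
    refine setIntegral_mono_set hint ?_ hsub.eventuallyLE
    filter_upwards [ae_restrict_mem measurableSet_Ioi] with s hs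
    have hs' : 0 < s := hs
    show 0 ≤ _
    positivity
  rw [Real.integral_rpow_mul_exp_neg_mul_Ioi (by linarith) hl] at h2
  rw [integral_const_mul, integral_exp_mul_Ioi (neg_lt_zero.2 hl)] at h1
  have h3 := h1.trans h2
  have h4 : t ^ (a - 1) * exp (-(l * t)) = l * (t ^ (a - 1) * (-exp (-l * t) / -l)) := by
    rw [neg_mul]
    field_simp
  rw [h4]
  gcongr

theorem integral_sub_sq_mul_rpow_mul_exp {a l : ℝ} (ha : 0 < a) (hl : 0 < l) :
    IntegrableOn (fun s : ℝ => (s - a / l) ^ 2 * (s ^ (a - 1) * exp (-(l * s)))) (Set.Ioi 0) ∧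
    ∫ s in Set.Ioi 0, (s - a / l) ^ 2 * (s ^ (a - 1) * exp (-(l * s))) =
      a / l ^ 2 * ((1 / l) ^ a * Real.Gamma a) := by
  have i0 := integrableOn_rpow_mul_exp_neg_mul ha hl
  have i1 := integrableOn_rpow_mul_exp_neg_mul (by linarith : 0 < a + 1) hl
  have i2 := integrableOn_rpow_mul_exp_neg_mul (by linarith : 0 < a + 1 + 1) hl
  have hcongr : Set.EqOn (fun s : ℝ => s ^ (a + 1 + 1 - 1) * exp (-(l * s)) -
        2 * (a / l) * (s ^ (a + 1 - 1) * exp (-(l * s))) +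
        (a / l) ^ 2 * (s ^ (a - 1) * exp (-(l * s))))
      (fun s : ℝ => (s - a / l) ^ 2 * (s ^ (a - 1) * exp (-(l * s)))) (Set.Ioi 0) := by
    intro s hs
    have hs' : 0 < s := hs
    have e1 : s ^ (a + 1 - 1) = s ^ (a - 1) * s := by
      rw [← Real.rpow_add_one hs'.ne']
      ring_nf
    have e2 : s ^ (a + 1 + 1 - 1) = s ^ (a - 1) * s * s := by
      rw [← e1, ← Real.rpow_add_one hs'.ne']
      ring_nf
    simp only [e1, e2]
    ring
  have i12 : IntegrableOn (fun s : ℝ => s ^ (a + 1 + 1 - 1) * exp (-(l * s)) -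
      2 * (a / l) * (s ^ (a + 1 - 1) * exp (-(l * s)))) (Set.Ioi 0) := i2.sub (i1.const_mul _)
  refine ⟨(i12.add (i0.const_mul _)).congr_fun hcongr measurableSet_Ioi, ?_⟩
  rw [← setIntegral_congr_fun measurableSet_Ioi hcongr,
    integral_add i12 (i0.const_mul _),
    integral_sub i2 (i1.const_mul _), integral_const_mul, integral_const_mul,
    Real.integral_rpow_mul_exp_neg_mul_Ioi ha hl,
    Real.integral_rpow_mul_exp_neg_mul_Ioi (by linarith) hl,
    Real.integral_rpow_mul_exp_neg_mul_Ioi (by linarith) hl,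
    Real.Gamma_add_one (by linarith), Real.Gamma_add_one (by linarith),
    Real.rpow_add_one (by positivity), Real.rpow_add_one (by positivity)]
  field_simp
  ring

theorem integral_rpow_mul_exp_mul_le {a l r₁ r₂ : ℝ} (ha : 1 ≤ a) (hl : 0 < l)
    (hr₁ : 0 ≤ r₁) (hr₁' : r₁ ≤ a / l / 2) (hr₂ : 2 * (a / l) ≤ r₂) {h : ℝ → ℝ}
    (hm : Measurable h) (h0 : ∀ s, 0 ≤ h s) (h1 : ∀ s, h s ≤ 1) :
    ∫ s in Set.Ioi 0, s ^ (a - 1) * exp (-(l * s)) * h s ≤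
      (l * (∫ s in r₁..r₂, h s) + 4 / a) * ((1 / l) ^ a * Real.Gamma a) := by
  have ha0 : 0 < a := by linarith
  have hG := Real.Gamma_pos_of_pos ha0
  have hτ : 0 < a / l := by positivity
  obtain ⟨iv, ev⟩ := integral_sub_sq_mul_rpow_mul_exp ha0 hl
  have hle : r₁ ≤ r₂ := by linarith
  have iI : IntegrableOn h (Set.Ioc r₁ r₂) := by
    refine Measure.integrableOn_of_bounded (M := 1) (by simp) hm.aestronglyMeasurable
      (ae_of_all _ fun s => ?_)
    rw [Real.norm_of_nonneg (h0 s)]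
    exact h1 s
  set M := l * ((1 / l) ^ a * Real.Gamma a) with hM
  have iJ : IntegrableOn ((Set.Ioc r₁ r₂).indicator fun s => M * h s) (Set.Ioi 0) :=
    ((integrable_indicator_iff measurableSet_Ioc).2 (iI.const_mul M)).integrableOn
  have hbound : ∀ s ∈ Set.Ioi (0 : ℝ), s ^ (a - 1) * exp (-(l * s)) * h s ≤
      (Set.Ioc r₁ r₂).indicator (fun s => M * h s) s +
        4 / (a / l) ^ 2 * ((s - a / l) ^ 2 * (s ^ (a - 1) * exp (-(l * s)))) := by
    intro s hs
    have hs' : 0 < s := hs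
    by_cases hmem : s ∈ Set.Ioc r₁ r₂
    · rw [Set.indicator_of_mem hmem]
      refine le_add_of_le_of_nonneg ?_ (by positivity)
      exact mul_le_mul_of_nonneg_right (rpow_mul_exp_neg_mul_le ha hl hs') (h0 s)
    · rw [Set.indicator_of_notMem hmem, zero_add, ← mul_assoc]
      refine (mul_le_of_le_one_right (by positivity) (h1 s)).trans
        (le_mul_of_one_le_left (by positivity) ?_)
      rw [div_mul_eq_mul_div, one_le_div (by positivity)]
      have : s ≤ r₁ ∨ r₂ < s := by
        by_contra! hc
        exact hmem hc
      rcases this with h | h <;> nlinarith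
  have i0 : IntegrableOn (fun s => s ^ (a - 1) * exp (-(l * s)) * h s) (Set.Ioi 0) := by
    refine (integrableOn_rpow_mul_exp_neg_mul ha0 hl).mul_bdd (c := 1) hm.aestronglyMeasurable
      (ae_of_all _ fun s => ?_)
    rw [Real.norm_of_nonneg (h0 s)]
    exact h1 s
  have hsub : Set.Ioc r₁ r₂ ⊆ Set.Ioi 0 := fun s hs => hr₁.trans_lt hs.1
  refine (setIntegral_mono_on i0 (iJ.add (iv.const_mul _)) measurableSet_Ioi hbound).trans
    (le_of_eq ?_)
  rw [integral_add' iJ (iv.const_mul _), integral_const_mul, ev,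
    setIntegral_indicator measurableSet_Ioc,
    Set.inter_eq_right.2 hsub, integral_const_mul,
    intervalIntegral.integral_of_le hle, hM]
  field_simp

theorem sphereUniform_isProbabilityMeasure {d : ℕ} (hd : 0 < d) :
    IsProbabilityMeasure (sphereUniform d) := by
  have : NeZero d := ⟨hd.ne'⟩
  refine ⟨?_⟩
  rw [sphereUniform, Measure.smul_apply, smul_eq_mul]
  exact ENNReal.inv_mul_cancel (Measure.measure_univ_ne_zero.2 (Measure.toSphere_ne_zero _))
    (measure_ne_top _ _)

theorem measurable_sphAvg {d : ℕ} (hd : 0 < d) {f : EuclideanSpace ℝ (Fin d) → ℝ}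
    (hf : Measurable f) : Measurable (sphAvg d f) := by
  have := sphereUniform_isProbabilityMeasure hd
  have hm : Measurable (fun p : ℝ × Metric.sphere (0 : EuclideanSpace ℝ (Fin d)) 1 =>
      f (Real.sqrt p.1 • (p.2 : EuclideanSpace ℝ (Fin d)))) := by
    fun_prop
  exact (hm.stronglyMeasurable.integral_prod_right (ν := sphereUniform d)).measurable

theorem sphAvg_nonneg {d : ℕ} {f : EuclideanSpace ℝ (Fin d) → ℝ} (h0 : ∀ x, 0 ≤ f x) (s : ℝ) :
    0 ≤ sphAvg d f s :=
  integral_nonneg fun _ => h0 _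

theorem sphAvg_le_one {d : ℕ} (hd : 0 < d) {f : EuclideanSpace ℝ (Fin d) → ℝ}
    (h0 : ∀ x, 0 ≤ f x) (h1 : ∀ x, f x ≤ 1) (s : ℝ) : sphAvg d f s ≤ 1 := by
  have := sphereUniform_isProbabilityMeasure hd
  refine (integral_mono_of_nonneg (ae_of_all _ fun _ => h0 _) (integrable_const (1 : ℝ))
    (ae_of_all _ fun _ => h1 _)).trans ?_
  simp

theorem integral_toSphere {d : ℕ} (hd : 0 < d)
    (φ : Metric.sphere (0 : EuclideanSpace ℝ (Fin d)) 1 → ℝ) :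
    ∫ ω, φ ω ∂(volume : Measure (EuclideanSpace ℝ (Fin d))).toSphere =
      (volume : Measure (EuclideanSpace ℝ (Fin d))).toSphere.real Set.univ *
        ∫ ω, φ ω ∂(sphereUniform d) := by
  have : NeZero d := ⟨hd.ne'⟩
  have h : (volume : Measure (EuclideanSpace ℝ (Fin d))).toSphere.real Set.univ ≠ 0 := by
    rw [measureReal_def]
    exact ENNReal.toReal_ne_zero.2
      ⟨Measure.measure_univ_ne_zero.2 (Measure.toSphere_ne_zero _), measure_ne_top _ _⟩
  rw [sphereUniform, integral_smul_measure, ENNReal.toReal_inv, smul_eq_mul, ← measureReal_def,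
    mul_inv_cancel_left₀ h]

theorem integral_Ioi_comp_sq {a l : ℝ} {d : ℕ} (hd : 0 < d) (had : a = d / 2) (h : ℝ → ℝ) :
    ∫ r in Set.Ioi (0 : ℝ), r ^ (d - 1) * (exp (-l * r ^ 2) * h (r ^ 2)) =
      (1 / 2) * ∫ s in Set.Ioi (0 : ℝ), s ^ (a - 1) * exp (-(l * s)) * h s := by
  rw [← integral_comp_rpow_Ioi_of_pos (p := 2)
      (g := fun s => s ^ (a - 1) * exp (-(l * s)) * h s) two_pos, ← integral_const_mul]
  refine setIntegral_congr_fun measurableSet_Ioi fun r hr => ?_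
  have hr' : 0 < r := hr
  have e1 : (r ^ (2 : ℝ)) ^ (a - 1) * r = r ^ (d - 1) := by
    rw [← Real.rpow_mul hr'.le, ← Real.rpow_add_one hr'.ne', ← Real.rpow_natCast,
      Nat.cast_pred hd, had]
    ring_nf
  have e2 : r ^ ((2 : ℝ) - 1) = r := by norm_num
  have e3 : r ^ (2 : ℝ) = r ^ 2 := by norm_cast
  simp only [smul_eq_mul]
  rw [← e1, e2, e3, neg_mul]
  ring

theorem integral_mul_exp_neg_norm_sq_polar {d : ℕ} (hd : 0 < d) {a l : ℝ} (had : a = d / 2)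
    (hl : 0 < l) {f : EuclideanSpace ℝ (Fin d) → ℝ} (hf : Measurable f) (hf1 : ∀ x, |f x| ≤ 1) :
    ∫ x, f x * exp (-l * ‖x‖ ^ 2) =
      (volume : Measure (EuclideanSpace ℝ (Fin d))).toSphere.real Set.univ / 2 *
        ∫ s in Set.Ioi (0 : ℝ), s ^ (a - 1) * exp (-(l * s)) * sphAvg d f s := by
  have : NeZero d := ⟨hd.ne'⟩
  let μ : Measure (EuclideanSpace ℝ (Fin d)) := volume
  let F : EuclideanSpace ℝ (Fin d) → ℝ := fun x => f x * exp (-l * ‖x‖ ^ 2)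
  have hF : Integrable F μ := (integrable_exp_neg_mul_sq_norm hl).bdd_mul
    hf.aestronglyMeasurable (ae_of_all _ hf1)
  let G : Metric.sphere (0 : EuclideanSpace ℝ (Fin d)) 1 × Set.Ioi (0 : ℝ) → ℝ :=
    fun p => F (p.2.1 • (p.1 : EuclideanSpace ℝ (Fin d)))
  have hGF : ∀ x : ({(0)}ᶜ : Set (EuclideanSpace ℝ (Fin d))),
      G (homeomorphUnitSphereProd _ x) = F x := by
    intro x
    have hx : ‖(x : EuclideanSpace ℝ (Fin d))‖ ≠ 0 := norm_ne_zero_iff.2 x.2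
    simp [G, smul_smul, hx]
  have hmp := μ.measurePreserving_homeomorphUnitSphereProd
  have hemb := (homeomorphUnitSphereProd (EuclideanSpace ℝ (Fin d))).measurableEmbedding
  have hG : Integrable G (μ.toSphere.prod
      (Measure.volumeIoiPow (Module.finrank ℝ (EuclideanSpace ℝ (Fin d)) - 1))) := by
    rw [← hmp.integrable_comp_emb hemb]
    have : G ∘ homeomorphUnitSphereProd _ = F ∘ Subtype.val := funext hGF
    rw [this, ← MeasurableEmbedding.integrableOn_range_iff_comap
      (MeasurableEmbedding.subtype_coe (measurableSet_singleton _).compl)]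
    exact hF.integrableOn
  calc
    ∫ x, F x ∂μ = ∫ x : ({(0)}ᶜ : Set (EuclideanSpace ℝ (Fin d))), F x ∂(μ.comap (↑)) := by
      rw [integral_subtype_comap (measurableSet_singleton _).compl F,
        restrict_compl_singleton]
    _ = ∫ p, G p ∂(μ.toSphere.prod
        (Measure.volumeIoiPow (Module.finrank ℝ (EuclideanSpace ℝ (Fin d)) - 1))) := by
      rw [← hmp.integral_comp hemb]
      simp only [hGF]
    _ = ∫ r : Set.Ioi (0 : ℝ), ∫ ω, G (ω, r) ∂μ.toSphere
        ∂(Measure.volumeIoiPow (Module.finrank ℝ (EuclideanSpace ℝ (Fin d)) - 1)) :=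
      integral_prod_symm _ hG
    _ = ∫ r : Set.Ioi (0 : ℝ), μ.toSphere.real Set.univ *
          (exp (-l * r.1 ^ 2) * sphAvg d f (r.1 ^ 2))
        ∂(Measure.volumeIoiPow (d - 1)) := by
      rw [finrank_euclideanSpace_fin]
      refine integral_congr_ae (ae_of_all _ fun r => ?_)
      have hr : (0 : ℝ) < r := r.2
      simp only [G, F, norm_smul, norm_eq_of_mem_sphere, mul_one, Real.norm_of_nonneg hr.le]
      rw [integral_mul_const, integral_toSphere hd, sphAvg, Real.sqrt_sq hr.le]
      ring
    _ = μ.toSphere.real Set.univ *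
        ∫ r in Set.Ioi (0 : ℝ), r ^ (d - 1) * (exp (-l * r ^ 2) * sphAvg d f (r ^ 2)) := by
      rw [integral_const_mul]
      congr 1
      simp only [Measure.volumeIoiPow, ENNReal.ofReal]
      rw [integral_withDensity_eq_integral_smul
          (measurable_subtype_coe.pow_const _).real_toNNReal,
        integral_subtype_comap measurableSet_Ioi fun r : ℝ =>
          Real.toNNReal (r ^ (d - 1)) • (exp (-l * r ^ 2) * sphAvg d f (r ^ 2))]
      refine setIntegral_congr_fun measurableSet_Ioi fun r hr => ?_
      simp only [NNReal.smul_def, Real.coe_toNNReal _ (pow_nonneg (Set.mem_Ioi.1 hr).le _),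
        smul_eq_mul]
    _ = _ := by
      rw [integral_Ioi_comp_sq hd had]
      ring

theorem toSphere_real_univ_mul_Gamma {d : ℕ} (hd : 0 < d) :
    (volume : Measure (EuclideanSpace ℝ (Fin d))).toSphere.real Set.univ / 2 *
      Real.Gamma ((d : ℝ) / 2) = π ^ ((d : ℝ) / 2) := by
  have := sphereUniform_isProbabilityMeasure hd
  have h := integral_mul_exp_neg_norm_sq_polar hd rfl one_pos (f := fun _ => 1)
    measurable_const (by simp)
  have hs : ∀ s, sphAvg d (fun _ => 1) s = 1 := fun s => by simp [sphAvg]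
  simp only [hs, one_mul, mul_one] at h
  rw [GaussianFourier.integral_rexp_neg_mul_sq_norm one_pos] at h
  have h2 := Real.integral_rpow_mul_exp_neg_mul_Ioi (a := (d : ℝ) / 2) (by positivity) one_pos
  simp only [one_mul] at h2
  rw [h2] at h
  simpa using h.symm

theorem gaussian_average_le {d : ℕ} (hd : 2 ≤ d) {l r₁ r₂ : ℝ} (hl : 0 < l) (hr₁ : 0 ≤ r₁)
    (hr₁' : r₁ ≤ d / (2 * l) / 2) (hr₂ : 2 * (d / (2 * l)) ≤ r₂)
    {f : EuclideanSpace ℝ (Fin d) → ℝ} (hf : Measurable f) (h0 : ∀ x, 0 ≤ f x)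
    (h1 : ∀ x, f x ≤ 1) :
    (l / π) ^ ((d : ℝ) / 2) * ∫ x, f x * exp (-l * ‖x‖ ^ 2) ≤
      l * (∫ s in r₁..r₂, sphAvg d f s) + 8 / d := by
  have hd0 : 0 < d := by omega
  have hd' : (2 : ℝ) ≤ d := by exact_mod_cast hd
  have hτ : (d : ℝ) / 2 / l = d / (2 * l) := by field_simp
  have key := integral_rpow_mul_exp_mul_le (a := (d : ℝ) / 2) (r₁ := r₁) (r₂ := r₂) (by linarith) hl hr₁
    (by rwa [hτ]) (by rwa [hτ]) (measurable_sphAvg hd0 hf) (sphAvg_nonneg h0)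
    (sphAvg_le_one hd0 h0 h1)
  have hG : 0 < Real.Gamma ((d : ℝ) / 2) := Real.Gamma_pos_of_pos (by positivity)
  have hc := toSphere_real_univ_mul_Gamma hd0
  have hc' : (volume : Measure (EuclideanSpace ℝ (Fin d))).toSphere.real Set.univ / 2 =
      π ^ ((d : ℝ) / 2) / Real.Gamma ((d : ℝ) / 2) := by
    rw [eq_div_iff hG.ne', hc]
  rw [integral_mul_exp_neg_norm_sq_polar hd0 rfl hl hf
    (fun x => abs_le.2 ⟨by linarith [h0 x], h1 x⟩), hc', ← mul_assoc,
    Real.div_rpow hl.le pi_pos.le]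
  have hl' := Real.rpow_pos_of_pos hl ((d : ℝ) / 2)
  have hpi := Real.rpow_pos_of_pos pi_pos ((d : ℝ) / 2)
  have e : l ^ ((d : ℝ) / 2) / π ^ ((d : ℝ) / 2) *
      (π ^ ((d : ℝ) / 2) / Real.Gamma ((d : ℝ) / 2)) =
      l ^ ((d : ℝ) / 2) / Real.Gamma ((d : ℝ) / 2) := by
    field_simp
  rw [e]
  refine (mul_le_mul_of_nonneg_left key (by positivity)).trans (le_of_eq ?_)
  rw [Real.div_rpow one_pos.le hl.le, Real.one_rpow]
  field_simp
  ring

theorem hasDerivAt_gaussian_average {d : ℕ} {f : EuclideanSpace ℝ (Fin d) → ℝ}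
    (hf : Measurable f) (hf1 : ∀ x, |f x| ≤ 1) {l : ℝ} (hl : 0 < l) :
    HasDerivAt (fun t => (t / π) ^ ((d : ℝ) / 2) * ∫ x, f x * exp (-t * ‖x‖ ^ 2))
      (d / (2 * l) * ((l / π) ^ ((d : ℝ) / 2) * ∫ x, f x * exp (-l * ‖x‖ ^ 2)) -
        (l / π) ^ ((d : ℝ) / 2) * ∫ x, f x * (‖x‖ ^ 2 * exp (-l * ‖x‖ ^ 2))) l := by
  have h1 := ((hasDerivAt_id l).div_const π).rpow_const (p := (d : ℝ) / 2)
    (Or.inl (div_pos hl pi_pos).ne')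
  refine (h1.mul (hasDerivAt_integral_mul_exp hf hf1 hl)).congr_deriv ?_
  simp only [id]
  rw [Real.rpow_sub_one (by positivity)]
  have := pi_ne_zero
  field_simp
  ring

theorem gaussian_second_moment_lt {d : ℕ} (hd : 0 < d) {f : EuclideanSpace ℝ (Fin d) → ℝ}
    (hf : Measurable f) (hf1 : ∀ x, |f x| ≤ 1) {l c : ℝ} (hl : 0 < l)
    (h : ∀ u : EuclideanSpace ℝ (Fin d), ‖u‖ = 1 →
      ∫ x, ⟪u, x⟫ ^ 2 * f x ∂(gaussianE d (1 / (2 * l))) < c) :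
    (l / π) ^ ((d : ℝ) / 2) * ∫ x, f x * (‖x‖ ^ 2 * exp (-l * ‖x‖ ^ 2)) < d * c := by
  have : NeZero d := ⟨hd.ne'⟩
  let b := EuclideanSpace.basisFun (Fin d) ℝ
  have hint : ∀ i ∈ Finset.univ,
      Integrable (fun x => ⟪b i, x⟫ ^ 2 * f x * exp (-l * ‖x‖ ^ 2)) := by
    intro i _
    refine (integrable_sq_norm_mul_exp hl).mono' (by fun_prop) (ae_of_all _ fun x => ?_)
    have hi : ⟪b i, x⟫ ^ 2 ≤ ‖x‖ ^ 2 := by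
      have := abs_real_inner_le_norm (b i) x
      rw [b.norm_eq_one, one_mul] at this
      exact sq_le_sq.2 (this.trans (le_abs_self _))
    rw [norm_mul, norm_mul, Real.norm_of_nonneg (Real.exp_pos _).le,
      Real.norm_of_nonneg (sq_nonneg _)]
    refine mul_le_mul_of_nonneg_right ?_ (Real.exp_pos _).le
    exact (mul_le_of_le_one_right (sq_nonneg _) (hf1 x)).trans hi
  have hsum : (l / π) ^ ((d : ℝ) / 2) * ∫ x, f x * (‖x‖ ^ 2 * exp (-l * ‖x‖ ^ 2)) =
      ∑ i, ∫ x, ⟪b i, x⟫ ^ 2 * f x ∂(gaussianE d (1 / (2 * l))) := by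
    simp only [integral_gaussianE d hl]
    rw [← Finset.mul_sum, ← integral_finsetSum _ hint]
    congr 1
    refine integral_congr_ae (ae_of_all _ fun x => ?_)
    simp only
    rw [← Finset.sum_mul, ← Finset.sum_mul, b.sum_sq_inner_right]
    ring
  rw [hsum]
  calc _ < ∑ _i : Fin d, c :=
        Finset.sum_lt_sum_of_nonempty Finset.univ_nonempty fun i _ => h _ (b.norm_eq_one i)
    _ = d * c := by simp

theorem gaussianE_real_setOf_eq_one {d : ℕ} {f : EuclideanSpace ℝ (Fin d) → ℝ}
    (hf : Measurable f) (hf01 : ∀ x, f x = 0 ∨ f x = 1) {l : ℝ} (hl : 0 < l) :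
    ((gaussianE d (1 / (2 * l))) {x | f x = 1}).toReal =
      (l / π) ^ ((d : ℝ) / 2) * ∫ x, f x * exp (-l * ‖x‖ ^ 2) := by
  have hs : MeasurableSet {x | f x = 1} := hf (measurableSet_singleton 1)
  rw [← integral_gaussianE d hl, ← measureReal_def, ← integral_indicator_one hs]
  refine integral_congr_ae (ae_of_all _ fun x => ?_)
  rcases hf01 x with h | h <;> simp [h]

theorem sphAvg_one_sub {d : ℕ} (hd : 0 < d) {f : EuclideanSpace ℝ (Fin d) → ℝ}
    (hf : Measurable f) (hf1 : ∀ x, |f x| ≤ 1) (s : ℝ) :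
    sphAvg d (fun x => 1 - f x) s = 1 - sphAvg d f s := by
  have := sphereUniform_isProbabilityMeasure hd
  have hi : Integrable (fun ω : Metric.sphere (0 : EuclideanSpace ℝ (Fin d)) 1 =>
      f (Real.sqrt s • (ω : EuclideanSpace ℝ (Fin d)))) (sphereUniform d) :=
    Integrable.of_bound (by fun_prop : Measurable _).aestronglyMeasurable 1
      (ae_of_all _ fun _ => hf1 _)
  rw [sphAvg, integral_sub (integrable_const _) hi]
  simp [sphAvg]

theorem gaussian_average_one_sub {d : ℕ} {f : EuclideanSpace ℝ (Fin d) → ℝ}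
    (hf : Measurable f) (hf1 : ∀ x, |f x| ≤ 1) {l : ℝ} (hl : 0 < l) :
    (l / π) ^ ((d : ℝ) / 2) * ∫ x, (1 - f x) * exp (-l * ‖x‖ ^ 2) =
      1 - (l / π) ^ ((d : ℝ) / 2) * ∫ x, f x * exp (-l * ‖x‖ ^ 2) := by
  have hi := integrable_exp_neg_mul_sq_norm (V := EuclideanSpace ℝ (Fin d)) hl
  simp only [sub_mul, one_mul]
  rw [integral_sub hi (hi.bdd_mul hf.aestronglyMeasurable (ae_of_all _ hf1)),
    GaussianFourier.integral_rexp_neg_mul_sq_norm hl, mul_sub, finrank_euclideanSpace_fin,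
    ← Real.mul_rpow (by positivity) (by positivity), div_mul_div_cancel₀ pi_ne_zero,
    div_self hl.ne', Real.one_rpow]

theorem stmt7 :
    ∃ d₀ : ℕ, ∀ d : ℕ, d₀ ≤ d → ∀ B : ℝ, 4 ≤ B →
      ∀ f : EuclideanSpace ℝ (Fin d) → ℝ, Measurable f → (∀ x, f x = 0 ∨ f x = 1) →
      (∫ s in (B * d / 2)..(2 * B * d), (1 - sphAvg d f s)) ≤ 1 / (B * d) →
      (∫ s in (0 : ℝ)..(2 * d), sphAvg d f s) ≤ 1 / d →
      ∃ τ ∈ Set.Icc (d : ℝ) (B * d), ∃ u : EuclideanSpace ℝ (Fin d), ‖u‖ = 1 ∧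
        (τ / d + 1 / (4 * B * d)) * ((gaussianE d (τ / d)) {x | f x = 1}).toReal ≤
          (∫ x, ⟪u, x⟫ ^ 2 * f x ∂(gaussianE d (τ / d))) ∧
        1 / (40 * B ^ 2 * d) ≤ ((gaussianE d (τ / d)) {x | f x = 1}).toReal := by
  refine ⟨100, fun d hd B hB f hf hf01 hi hii => ?_⟩
  by_contra! hcon
  have hd' : (100 : ℝ) ≤ d := by exact_mod_cast hd
  have hd0 : 0 < d := by omega
  have hf0 : ∀ x, 0 ≤ f x := fun x => by rcases hf01 x with h | h <;> simp [h]
  have hf1 : ∀ x, f x ≤ 1 := fun x => by rcases hf01 x with h | h <;> simp [h]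
  have habs : ∀ x, |f x| ≤ 1 := fun x => by rw [abs_of_nonneg (hf0 x)]; exact hf1 x
  let p : ℝ → ℝ := fun t => (t / π) ^ ((d : ℝ) / 2) * ∫ x, f x * exp (-t * ‖x‖ ^ 2)
  let p' : ℝ → ℝ := fun t => d / (2 * t) * p t -
    (t / π) ^ ((d : ℝ) / 2) * ∫ x, f x * (‖x‖ ^ 2 * exp (-t * ‖x‖ ^ 2))
  let b : ℝ → ℝ := fun t => -(9 / 10 * exp (-(t - 1 / (2 * B)) / (4 * B)))
  have hB0 : 0 < B := by linarith
  have hpos : ∀ t, 1 / (2 * B) ≤ t → 0 < t := fun t ht => lt_of_lt_of_le (by positivity) ht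
  have hderiv : ∀ t, 1 / (2 * B) ≤ t → HasDerivAt p (p' t) t := fun t ht =>
    hasDerivAt_gaussian_average hf habs (hpos t ht)
  have h_end : p (1 / 2) ≤ 1 / 2 := by
    have h := gaussian_average_le (by omega) (l := 1 / 2) (r₁ := 0) (r₂ := 2 * d) one_half_pos
      le_rfl (by positivity) (by norm_num) hf hf0 hf1
    refine h.trans ?_
    have h2 : (1 : ℝ) / d ≤ 1 / 100 := by gcongr
    have h3 : (8 : ℝ) / d ≤ 8 / 100 := by gcongr
    linarith
  have h_start : 9 / 10 ≤ p (1 / (2 * B)) := by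
    have hB' : 1 / (2 * B) ≤ 1 := by
      rw [div_le_one (by positivity)]
      linarith
    have h := gaussian_average_le (by omega) (l := 1 / (2 * B)) (r₁ := B * d / 2)
      (r₂ := 2 * B * d) (by positivity) (by positivity) (le_of_eq (by field_simp))
      (le_of_eq (by field_simp)) (hf.const_sub 1) (fun x => sub_nonneg.2 (hf1 x))
      (fun x => sub_le_self _ (hf0 x))
    simp only [sphAvg_one_sub hd0 hf habs] at h
    rw [gaussian_average_one_sub hf habs (by positivity)] at h
    have h1 : 1 / (B * d) ≤ 1 / 100 := by
      gcongr
      nlinarith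
    have h2 : 1 / (2 * B) * (∫ s in (B * d / 2)..(2 * B * d), (1 - sphAvg d f s)) ≤ 1 / 100 :=
      (mul_le_mul_of_nonneg_left (hi.trans h1) (by positivity)).trans
        (mul_le_of_le_one_left (by norm_num) hB')
    have h3 : (8 : ℝ) / d ≤ 8 / 100 := by gcongr
    have h4 : 1 - p (1 / (2 * B)) ≤ _ := h
    linarith
  have hexp : ∀ t ≤ 1 / 2, 31 / 32 ≤ exp (-(t - 1 / (2 * B)) / (4 * B)) := by
    intro t ht
    have h := Real.add_one_le_exp (-(t - 1 / (2 * B)) / (4 * B))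
    have h2 : (t - 1 / (2 * B)) / (4 * B) ≤ 1 / 32 := by
      rw [div_le_iff₀ (by positivity)]
      have : 0 < 1 / (2 * B) := by positivity
      linarith
    rw [neg_div] at h ⊢
    linarith
  have hle : 1 / (2 * B) ≤ 1 / 2 := by
    gcongr
    linarith
  have hfence := image_le_of_deriv_right_lt_deriv_boundary (f := fun t => -p t)
    (f' := fun t => -p' t) (a := 1 / (2 * B)) (b := 1 / 2) (B := b)
    (B' := fun t => -(b t) * (1 / (4 * B)))
    (fun t ht => (hderiv t ht.1).neg.continuousAt.continuousWithinAt)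
    (fun t ht => (hderiv t ht.1).neg.hasDerivWithinAt)
    (by simpa [b] using h_start)
    (fun t => by
      have h := ((((hasDerivAt_id t).sub_const (1 / (2 * B))).neg.div_const (4 * B)).exp.const_mul
        (9 / 10)).neg
      refine h.congr_deriv ?_
      simp only [b, id, Pi.neg_apply]
      ring)
    (fun t ht heq => by
      have ht0 := hpos t ht.1
      have hpt : p t = -b t := by linarith
      have hlow : 1 / 2 ≤ p t := by
        have := hexp t ht.2.le
        rw [hpt]
        simp only [b]
        linarith
      have hτ : (d : ℝ) / (2 * t) / d = 1 / (2 * t) := by field_simp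
      have hc := hcon (d / (2 * t)) ⟨by
        rw [le_div_iff₀ (by positivity)]
        nlinarith [ht.2], by
        have := ht.1
        rw [div_le_iff₀ (by positivity)] at this ⊢
        nlinarith⟩
      rw [hτ, gaussianE_real_setOf_eq_one hf hf01 ht0] at hc
      have hsm : 1 / (40 * B ^ 2 * d) ≤ p t := by
        refine le_trans ?_ hlow
        gcongr
        nlinarith
      have hlt := gaussian_second_moment_lt hd0 hf habs (c := (1 / (2 * t) + 1 / (4 * B * d)) * p t)
        ht0 fun u hu => by
          by_contra! hge
          exact absurd hsm (not_le.2 (hc u hu hge))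
      have e : d * ((1 / (2 * t) + 1 / (4 * B * d)) * p t) =
          d / (2 * t) * p t + p t * (1 / (4 * B)) := by
        field_simp
      rw [e] at hlt
      simp only [p', ← hpt]
      linarith)
  have hfin := hfence (Set.right_mem_Icc.2 hle)
  have := hexp (1 / 2) le_rfl
  simp only [b] at hfin
  linarith
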